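/- Suppose X carries a topology making it a Polish space with Borel σ-algebra B(X), that sup_{x ∈ Φ\Ψ} Q(x, Φ\Ψ) < 1, and that Q has the strong Feller property, i.e. for every bounded measurable function f : X → ℝ the function x ↦ ∫_X f(ξ) Q(x, dξ) is continuous on X. Then the restriction of V to the set Φ\Ψ is continuous (as a function on the subspace Φ\Ψ). -/

import Mathlib

open MeasureTheory ProbabilityTheory Filter

/-- The operator `L[W](x) = 1_Ψ(x) + 1_{Φ\Ψ}(x) ∫_X W(ξ) Q(x,dξ)`. -/
noncomputable def Lop {X : Type*} [MeasurableSpace X] (Q : Kernel X X) (Φ Ψ : Set X)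
    (W : X → ℝ) (x : X) : ℝ :=
  Ψ.indicator (fun _ => (1 : ℝ)) x + (Φ \ Ψ).indicator (fun _ => ∫ ξ, W ξ ∂(Q x)) x

/-- The set `M_b^{01}(Φ,Ψ)`. -/
def Mb01 {X : Type*} [MeasurableSpace X] (Φ Ψ : Set X) : Set (X → ℝ) :=
  {W | Measurable W ∧ (∃ C, ∀ x, |W x| ≤ C) ∧ (∀ x, 0 ≤ W x) ∧ (∀ x, W x ≤ 1) ∧
    (∀ x ∈ Ψ, W x = 1) ∧ ∀ x ∈ (Φ ∪ Ψ)ᶜ, W x = 0}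

/-- The iterates `V_0 = 1_Ψ`, `V_{k+1} = L[V_k]`. -/
noncomputable def Vseq {X : Type*} [MeasurableSpace X] (Q : Kernel X X) (Φ Ψ : Set X) :
    ℕ → X → ℝ
  | 0 => Ψ.indicator (fun _ => (1 : ℝ))
  | (k + 1) => Lop Q Φ Ψ (Vseq Q Φ Ψ k)
theorem Vseq_aux {X : Type*} [TopologicalSpace X]
    [MeasurableSpace X] [BorelSpace X]
    (Q : Kernel X X) [IsMarkovKernel Q]
    (Φ Ψ : Set X) (hΦ : MeasurableSet Φ) (hΨ : MeasurableSet Ψ)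
    (hFeller : ∀ f : X → ℝ, Measurable f → (∃ C, ∀ x, |f x| ≤ C) →
      Continuous fun x => ∫ ξ, f ξ ∂(Q x)) (k : ℕ) :
    Measurable (Vseq Q Φ Ψ k) ∧ ∀ x, |Vseq Q Φ Ψ k x| ≤ 1 := by
  induction k with
  | zero =>
    refine ⟨measurable_const.indicator hΨ, fun x => ?_⟩
    by_cases h : x ∈ Ψ <;> simp [Vseq, h]
  | succ k ih =>
    obtain ⟨hm, hb⟩ := ih
    refine ⟨?_, fun x => ?_⟩
    · have h1 : Measurable fun x => ∫ ξ, Vseq Q Φ Ψ k ξ ∂(Q x) :=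
        (hFeller _ hm ⟨1, hb⟩).measurable
      have h2 : Measurable (Ψ.indicator (fun _ : X => (1 : ℝ))) := measurable_const.indicator hΨ
      exact h2.add (h1.indicator (hΦ.diff hΨ))
    · have h3 : |∫ ξ, Vseq Q Φ Ψ k ξ ∂(Q x)| ≤ 1 := by
        have := norm_integral_le_of_norm_le_const (μ := Q x) (f := Vseq Q Φ Ψ k) (C := 1)
          (Eventually.of_forall hb)
        simpa using this
      by_cases h : x ∈ Ψ
      · simp [Vseq, Lop, h]
      · by_cases h' : x ∈ Φ
        · simpa [Vseq, Lop, h, h'] using h3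
        · simp [Vseq, Lop, h, h']

/-- If `X` is Polish, `sup_{x ∈ Φ\Ψ} Q(x, Φ\Ψ) < 1`, and `Q` is strong Feller,
then the restriction of `V` to `Φ \ Ψ` is continuous. -/
theorem V_restrict_continuous {X : Type*} [TopologicalSpace X] [PolishSpace X]
    [MeasurableSpace X] [BorelSpace X] [Nonempty X]
    (Q : Kernel X X) [IsMarkovKernel Q]
    (Φ Ψ : Set X) (hΦ : MeasurableSet Φ) (hΨ : MeasurableSet Ψ)
    (hα : (⨆ x ∈ Φ \ Ψ, Q x (Φ \ Ψ)) < 1)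
    (hFeller : ∀ f : X → ℝ, Measurable f → (∃ C, ∀ x, |f x| ≤ C) →
      Continuous fun x => ∫ ξ, f ξ ∂(Q x))
    (V : X → ℝ) (hV : ∀ x, Tendsto (fun k => Vseq Q Φ Ψ k x) atTop (nhds (V x))) :
    Continuous ((Φ \ Ψ).restrict V) := by
  have aux := Vseq_aux Q Φ Ψ hΦ hΨ hFeller
  have hVm : Measurable V :=
    measurable_of_tendsto_metrizable (fun k => (aux k).1) (tendsto_pi_nhds.2 hV)
  have hVb : ∀ x, |V x| ≤ 1 := fun x =>
    le_of_tendsto (hV x).abs (Eventually.of_forall fun k => (aux k).2 x)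
  have hc := hFeller V hVm ⟨1, hVb⟩
  have heq : (Φ \ Ψ).restrict V = fun x : ↥(Φ \ Ψ) => ∫ ξ, V ξ ∂(Q x) := by
    funext ⟨x, hx⟩
    have ht : Tendsto (fun k => ∫ ξ, Vseq Q Φ Ψ k ξ ∂(Q x)) atTop (nhds (∫ ξ, V ξ ∂(Q x))) :=
      tendsto_integral_of_dominated_convergence (fun _ => (1 : ℝ))
        (fun k => (aux k).1.aestronglyMeasurable) (integrable_const _)
        (fun k => Eventually.of_forall (aux k).2) (Eventually.of_forall hV)
    have h1 := (tendsto_add_atTop_iff_nat 1).2 (hV x)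
    have h2 : (fun k => Vseq Q Φ Ψ (k + 1) x) = fun k => ∫ ξ, Vseq Q Φ Ψ k ξ ∂(Q x) := by
      funext k
      simp [Vseq, Lop, hx.1, hx.2]
    rw [h2] at h1
    exact tendsto_nhds_unique h1 ht
  rw [heq]
  exact hc.comp continuous_subtype_val
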